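/- arXiv:1801.06315 — 6 statements merged into one kernel-verified Lean document; each statement's English description precedes it below -/
import Mathlib

section
/- Let C' be the F₂-row space of the 4×8 matrix G' with rows (1,1,1,0,1,0,0,0), (1,0,1,1,0,1,0,0), (1,0,0,1,1,0,1,0), (1,0,0,0,1,1,0,1), and let C'' be the F₂-row space of the 4×8 matrix G'' with rows (1,1,0,1,1,0,0,0), (1,0,1,0,1,1,0,0), (1,0,0,1,0,1,1,0), (1,0,0,0,1,0,1,1). Then the Turyn set T = {(u+v, u+w, u+v+w) : v, w ∈ C', u ∈ C''} ⊆ F₂^24 is an F₂-linear subspace of F₂^24 of dimension 12, and the minimum Hamming weight of its nonzero elements equals 8 (so T is a binary (24,12,8) code). -/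
/-- Rows of the generator matrix `G'` of the `(8,4,4)` extended Hamming code `C'`. -/
def Gp : Fin 4 → (Fin 8 → ZMod 2) :=
  ![![1,1,1,0,1,0,0,0], ![1,0,1,1,0,1,0,0], ![1,0,0,1,1,0,1,0], ![1,0,0,0,1,1,0,1]]

/-- Rows of the generator matrix `G''` of the code `C''`. -/
def Gpp : Fin 4 → (Fin 8 → ZMod 2) :=
  ![![1,1,0,1,1,0,0,0], ![1,0,1,0,1,1,0,0], ![1,0,0,1,0,1,1,0], ![1,0,0,0,1,0,1,1]]

/-- The code `C'`, the row space of `G'`. -/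
def Cp : Submodule (ZMod 2) (Fin 8 → ZMod 2) := Submodule.span (ZMod 2) (Set.range Gp)

/-- The code `C''`, the row space of `G''`. -/
def Cpp : Submodule (ZMod 2) (Fin 8 → ZMod 2) := Submodule.span (ZMod 2) (Set.range Gpp)

/-- The Turyn set `T = {(u+v, u+w, u+v+w) : v, w ∈ C', u ∈ C''} ⊆ F₂²⁴`. -/
def TurynSet : Set (Fin 24 → ZMod 2) :=
  {x | ∃ v ∈ Cp, ∃ w ∈ Cp, ∃ u ∈ Cpp,
    x = Fin.append (Fin.append (u + v) (u + w)) (u + v + w)}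

/-- The element of `F₂` given by a bit. -/
def bitZ (b : Bool) : ZMod 2 := cond b 1 0

lemma bitZ_add (a b : Bool) : bitZ a + bitZ b = bitZ (xor a b) := by
  revert a b; decide

lemma bitZ_surj (x : ZMod 2) : ∃ b, x = bitZ b := by
  revert x; decide

lemma bitZ_eq_zero (a : Bool) : bitZ a = 0 ↔ a = false := by
  revert a; decide

/-- Weight of `(u+v, u+w, u+v+w)` for bits `u v w`. -/
def triW (u v w : Bool) : ℕ :=
  cond (or v w) (cond u 1 2) (cond u 3 0)

lemma triW_eq (u v w : Bool) :
    (bitZ (xor u v)).val + (bitZ (xor u w)).val + (bitZ (xor (xor u v) w)).val = triW u v w := by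
  revert u v w; decide

/-- The bitwise form of the weight of a Turyn word. -/
def wtB (a0 a1 a2 a3 b0 b1 b2 b3 c0 c1 c2 c3 : Bool) : ℕ :=
  triW (xor (xor (xor c0 c1) c2) c3) (xor (xor (xor a0 a1) a2) a3) (xor (xor (xor b0 b1) b2) b3)
  + triW c0 a0 b0
  + triW c1 (xor a0 a1) (xor b0 b1)
  + triW (xor c0 c2) (xor a1 a2) (xor b1 b2)
  + triW (xor (xor c0 c1) c3) (xor (xor a0 a2) a3) (xor (xor b0 b2) b3)
  + triW (xor c1 c2) (xor a1 a3) (xor b1 b3)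
  + triW (xor c2 c3) a2 b2
  + triW c3 a3 b3

/-- Conjunction over both bits. -/
def allB (f : Bool → Bool) : Bool := and (f false) (f true)

lemma allB_spec {f : Bool → Bool} (h : allB f = true) (b : Bool) : f b = true := by
  cases b <;> simp_all [allB]

lemma check_all :
    (allB fun a0 => allB fun a1 => allB fun a2 => allB fun a3 =>
     allB fun b0 => allB fun b1 => allB fun b2 => allB fun b3 =>
     allB fun c0 => allB fun c1 => allB fun c2 => allB fun c3 =>
      or (Nat.ble 8 (wtB a0 a1 a2 a3 b0 b1 b2 b3 c0 c1 c2 c3))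
        (!(or (or (or (or a0 a1) (or a2 a3)) (or (or b0 b1) (or b2 b3)))
          (or (or c0 c1) (or c2 c3))))) = true := by
  decide +kernel

/-- The Turyn words as a linear function of the coefficients. -/
def turynL : ((Fin 4 → ZMod 2) × (Fin 4 → ZMod 2) × (Fin 4 → ZMod 2)) →ₗ[ZMod 2]
    (Fin 24 → ZMod 2) where
  toFun p := Fin.append (Fin.append ((∑ i, p.2.2 i • Gpp i) + (∑ i, p.1 i • Gp i))
      ((∑ i, p.2.2 i • Gpp i) + (∑ i, p.2.1 i • Gp i)))
      ((∑ i, p.2.2 i • Gpp i) + (∑ i, p.1 i • Gp i) + (∑ i, p.2.1 i • Gp i))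
  map_add' p q := by
    funext k
    refine Fin.addCases (m := 16) (n := 8) (fun k => ?_) (fun k => ?_) k
    · refine Fin.addCases (m := 8) (n := 8) (fun k => ?_) (fun k => ?_) k
      · simp only [Pi.add_apply, Fin.append_left, Prod.fst_add, Prod.snd_add, add_smul,
          Finset.sum_add_distrib]
        ring
      · simp only [Pi.add_apply, Fin.append_left, Fin.append_right, Prod.fst_add, Prod.snd_add,
          add_smul, Finset.sum_add_distrib]
        ring
    · simp only [Pi.add_apply, Fin.append_right, Prod.fst_add, Prod.snd_add, add_smul,
        Finset.sum_add_distrib]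
      ring
  map_smul' r q := by
    funext k
    refine Fin.addCases (m := 16) (n := 8) (fun k => ?_) (fun k => ?_) k
    · refine Fin.addCases (m := 8) (n := 8) (fun k => ?_) (fun k => ?_) k
      · simp only [Pi.add_apply, Pi.smul_apply, Fin.append_left, Prod.smul_fst, Prod.smul_snd,
          smul_assoc, ← Finset.smul_sum, smul_add, RingHom.id_apply]
      · simp only [Pi.add_apply, Pi.smul_apply, Fin.append_left, Fin.append_right, Prod.smul_fst,
          Prod.smul_snd, smul_assoc, ← Finset.smul_sum, smul_add, RingHom.id_apply]
    · simp only [Pi.add_apply, Pi.smul_apply, Fin.append_right, Prod.smul_fst, Prod.smul_snd,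
        smul_assoc, ← Finset.smul_sum, smul_add, RingHom.id_apply]

lemma range_turynL : (LinearMap.range turynL : Set (Fin 24 → ZMod 2)) = TurynSet := by
  ext x
  simp only [SetLike.mem_coe, LinearMap.mem_range, TurynSet, Set.mem_setOf_eq, Cp, Cpp,
    Submodule.mem_span_range_iff_exists_fun]
  constructor
  · rintro ⟨⟨a, b, c⟩, rfl⟩
    exact ⟨_, ⟨a, rfl⟩, _, ⟨b, rfl⟩, _, ⟨c, rfl⟩, rfl⟩
  · rintro ⟨_, ⟨a, rfl⟩, _, ⟨b, rfl⟩, _, ⟨c, rfl⟩, rfl⟩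
    exact ⟨⟨a, b, c⟩, rfl⟩

lemma hammingNorm_eq_sum_val {n : ℕ} (x : Fin n → ZMod 2) :
    hammingNorm x = ∑ i, (x i).val := by
  have h : ∀ y : ZMod 2, (if y ≠ 0 then 1 else 0) = y.val := by decide
  simp only [hammingNorm, Finset.card_filter, h]

lemma hammingNorm_append3 (x y z : Fin 8 → ZMod 2) :
    hammingNorm (Fin.append (Fin.append x y) z : Fin 24 → ZMod 2)
      = ∑ i, ((x i).val + (y i).val + (z i).val) := by
  rw [hammingNorm_eq_sum_val]
  have h := Fin.sum_univ_add (a := 16) (b := 8)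
    (fun i => ((Fin.append (Fin.append x y) z : Fin 24 → ZMod 2) i).val)
  have h2 := Fin.sum_univ_add (a := 8) (b := 8)
    (fun i => ((Fin.append x y : Fin 16 → ZMod 2) i).val)
  refine h.trans ?_
  simp only [Fin.append_left, Fin.append_right, Finset.sum_add_distrib] at h2 ⊢
  rw [← h2]

lemma comb_Gp (a : Fin 4 → Bool) : (∑ i, bitZ (a i) • Gp i) = fun k => bitZ (
    (![xor (xor (xor (a 0) (a 1)) (a 2)) (a 3), a 0, xor (a 0) (a 1), xor (a 1) (a 2),
      xor (xor (a 0) (a 2)) (a 3), xor (a 1) (a 3), a 2, a 3] : Fin 8 → Bool) k) := by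
  funext k
  fin_cases k <;> simp [Fin.sum_univ_four, Gp, bitZ_add]

lemma comb_Gpp (a : Fin 4 → Bool) : (∑ i, bitZ (a i) • Gpp i) = fun k => bitZ (
    (![xor (xor (xor (a 0) (a 1)) (a 2)) (a 3), a 0, a 1, xor (a 0) (a 2),
      xor (xor (a 0) (a 1)) (a 3), xor (a 1) (a 2), xor (a 2) (a 3), a 3] : Fin 8 → Bool) k) := by
  funext k
  fin_cases k <;> simp [Fin.sum_univ_four, Gpp, bitZ_add]

lemma norm_turynL (a b c : Fin 4 → Bool) :
    hammingNorm (turynL (fun i => bitZ (a i), fun i => bitZ (b i), fun i => bitZ (c i)))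
      = wtB (a 0) (a 1) (a 2) (a 3) (b 0) (b 1) (b 2) (b 3) (c 0) (c 1) (c 2) (c 3) := by
  refine (hammingNorm_append3 _ _ _).trans ?_
  simp only [comb_Gp, comb_Gpp, Pi.add_apply, bitZ_add, triW_eq]
  rw [Fin.sum_univ_eight]
  rfl

lemma turynL_weight (p : (Fin 4 → ZMod 2) × (Fin 4 → ZMod 2) × (Fin 4 → ZMod 2)) :
    p = 0 ∨ 8 ≤ hammingNorm (turynL p) := by
  obtain ⟨a', b', c'⟩ := p
  choose a ha using fun i => bitZ_surj (a' i)
  choose b hb using fun i => bitZ_surj (b' i)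
  choose c hc using fun i => bitZ_surj (c' i)
  obtain rfl := funext ha
  obtain rfl := funext hb
  obtain rfl := funext hc
  rw [norm_turynL]
  have h := allB_spec (allB_spec (allB_spec (allB_spec (allB_spec (allB_spec (allB_spec
    (allB_spec (allB_spec (allB_spec (allB_spec (allB_spec check_all (a 0)) (a 1)) (a 2)) (a 3))
    (b 0)) (b 1)) (b 2)) (b 3)) (c 0)) (c 1)) (c 2)) (c 3)
  rw [Bool.or_eq_true, Nat.ble_eq] at h
  rcases h with h | h
  · exact Or.inr h
  · left
    simp only [Bool.not_eq_true', Bool.or_eq_false_iff] at h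
    simp only [Prod.mk_eq_zero, funext_iff, Pi.zero_apply, bitZ_eq_zero, Fin.forall_fin_succ]
    simpa [and_assoc] using h

lemma turynL_injective : Function.Injective turynL := by
  rw [injective_iff_map_eq_zero]
  intro p hp
  rcases turynL_weight p with h | h
  · exact h
  · rw [hp, hammingNorm_zero] at h
    omega

/-- The Turyn construction applied to `C'` and `C''` yields a binary `(24,12,8)` code:
the Turyn set is a 12-dimensional `F₂`-linear subspace of `F₂²⁴` whose minimum nonzero
Hamming weight is `8`. -/
theorem turyn_golay_24_12_8 :
    (∃ S : Submodule (ZMod 2) (Fin 24 → ZMod 2),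
        (S : Set (Fin 24 → ZMod 2)) = TurynSet ∧ Module.finrank (ZMod 2) S = 12) ∧
    (∀ x ∈ TurynSet, x ≠ 0 → 8 ≤ hammingNorm x) ∧
    (∃ x ∈ TurynSet, hammingNorm x = 8) := by
  refine ⟨⟨LinearMap.range turynL, range_turynL, ?_⟩, ?_, ?_⟩
  · rw [LinearMap.finrank_range_of_inj turynL_injective]
    simp [Module.finrank_prod]
  · intro x hx hx0
    rw [← range_turynL] at hx
    obtain ⟨p, rfl⟩ := hx
    rcases turynL_weight p with h | h
    · exact absurd (by rw [h, map_zero]) hx0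
    · exact h
  · refine ⟨turynL (fun i => bitZ (![true, false, false, false] i), fun i => bitZ false,
      fun i => bitZ false), ?_, ?_⟩
    · rw [← range_turynL]
      exact ⟨_, rfl⟩
    · rw [norm_turynL ![true, false, false, false] (fun _ => false) (fun _ => false)]
      decide
end

section
/- Let a₁=(1,1,1,1,0,0,0,0), a₂=(1,0,1,0,1,0,1,0), a₃=(1,0,0,1,1,0,0,1), a₄=(1,0,0,1,0,1,1,0), b₁=(1,1,0,1,1,0,0,0), b₂=(1,0,1,1,0,0,1,0), b₃=(1,0,0,0,1,0,1,1), b₄=(1,0,0,1,0,1,0,1) in F₂^8, and let G be the 12×24 matrix over F₂ whose rows are (aᵢ, 0, aᵢ) for i=1,…,4, (0, aᵢ, aᵢ) for i=1,…,4, and (bᵢ, bᵢ, bᵢ) for i=1,…,4, where 0 denotes the zero vector of F₂^8. Let C_G be the F₂-row space of G (the extended Golay code). Then C_G has dimension 12 over F₂, every nonzero element of C_G has Hamming weight at least 8 with some element of weight exactly 8 (so C_G is a (24,12,8) code), and C_G is self-dual: C_G equals its dual code {x ∈ F₂^24 : Σ_i x_i·c_i = 0 for all c ∈ C_G}. -/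
/-- The vectors `a₁,…,a₄ ∈ F₂⁸`. -/
def av : Fin 4 → (Fin 8 → ZMod 2) :=
  ![![1,1,1,1,0,0,0,0], ![1,0,1,0,1,0,1,0], ![1,0,0,1,1,0,0,1], ![1,0,0,1,0,1,1,0]]

/-- The vectors `b₁,…,b₄ ∈ F₂⁸`. -/
def bv : Fin 4 → (Fin 8 → ZMod 2) :=
  ![![1,1,0,1,1,0,0,0], ![1,0,1,1,0,0,1,0], ![1,0,0,0,1,0,1,1], ![1,0,0,1,0,1,0,1]]

/-- The rows of the `12×24` generator matrix `G` of the extended Golay code: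
`(aᵢ, 0, aᵢ)`, `(0, aᵢ, aᵢ)` and `(bᵢ, bᵢ, bᵢ)` for `i = 1,…,4`. -/
def golayRows : Fin 12 → (Fin 24 → ZMod 2) :=
  Fin.append (Fin.append
    (fun i : Fin 4 => Fin.append (Fin.append (av i) (0 : Fin 8 → ZMod 2)) (av i))
    (fun i : Fin 4 => Fin.append (Fin.append (0 : Fin 8 → ZMod 2) (av i)) (av i)))
    (fun i : Fin 4 => Fin.append (Fin.append (bv i) (bv i)) (bv i))

/-- The extended Golay code `C_G`, the row space of `G`. -/
def CG : Submodule (ZMod 2) (Fin 24 → ZMod 2) := Submodule.span (ZMod 2) (Set.range golayRows)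

/-- The weight of the codeword with Boolean coefficients `b0,…,b11`. -/
def golayWt (b0 b1 b2 b3 b4 b5 b6 b7 b8 b9 b10 b11 : Bool) : ℕ :=
    (xor (xor (xor (xor (xor (xor (xor b0 b1) b2) b3) b8) b9) b10) b11).toNat +
    (xor b0 b8).toNat +
    (xor (xor b0 b1) b9).toNat +
    (xor (xor (xor (xor (xor b0 b2) b3) b8) b9) b11).toNat +
    (xor (xor (xor b1 b2) b8) b10).toNat +
    (xor b3 b11).toNat +
    (xor (xor (xor b1 b3) b9) b10).toNat +
    (xor (xor b2 b10) b11).toNat +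
    (xor (xor (xor (xor (xor (xor (xor b4 b5) b6) b7) b8) b9) b10) b11).toNat +
    (xor b4 b8).toNat +
    (xor (xor b4 b5) b9).toNat +
    (xor (xor (xor (xor (xor b4 b6) b7) b8) b9) b11).toNat +
    (xor (xor (xor b5 b6) b8) b10).toNat +
    (xor b7 b11).toNat +
    (xor (xor (xor b5 b7) b9) b10).toNat +
    (xor (xor b6 b10) b11).toNat +
    (xor (xor (xor (xor (xor (xor (xor (xor (xor (xor (xor b0 b1) b2) b3) b4) b5) b6) b7) b8) b9) b10) b11).toNat +
    (xor (xor b0 b4) b8).toNat +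
    (xor (xor (xor (xor b0 b1) b4) b5) b9).toNat +
    (xor (xor (xor (xor (xor (xor (xor (xor b0 b2) b3) b4) b6) b7) b8) b9) b11).toNat +
    (xor (xor (xor (xor (xor b1 b2) b5) b6) b8) b10).toNat +
    (xor (xor b3 b7) b11).toNat +
    (xor (xor (xor (xor (xor b1 b3) b5) b7) b9) b10).toNat +
    (xor (xor (xor b2 b6) b10) b11).toNat

/-- A Boolean as an element of `ZMod 2`. -/
def ofB (b : Bool) : ZMod 2 := cond b 1 0

theorem ofB_add (a b : Bool) : ofB a + ofB b = ofB (xor a b) := by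
  cases a <;> cases b <;> decide

theorem ofB_ite (a : Bool) : (if ofB a = 0 then 0 else 1) = a.toNat := by
  cases a <;> decide

theorem ofB_surj (z : ZMod 2) : ∃ b, z = ofB b := by
  revert z; decide

theorem golayWt_check : ∀ b0 b1 b2 b3 b4 b5 b6 b7 b8 b9 b10 b11 : Bool,
    8 ≤ golayWt b0 b1 b2 b3 b4 b5 b6 b7 b8 b9 b10 b11 ∨
    (b0 || b1 || b2 || b3 || b4 || b5 || b6 || b7 || b8 || b9 || b10 || b11) = false := by
  decide +kernel

theorem golayRows_eq : golayRows = ![![1,1,1,1,0,0,0,0,0,0,0,0,0,0,0,0,1,1,1,1,0,0,0,0],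
    ![1,0,1,0,1,0,1,0,0,0,0,0,0,0,0,0,1,0,1,0,1,0,1,0],
    ![1,0,0,1,1,0,0,1,0,0,0,0,0,0,0,0,1,0,0,1,1,0,0,1],
    ![1,0,0,1,0,1,1,0,0,0,0,0,0,0,0,0,1,0,0,1,0,1,1,0],
    ![0,0,0,0,0,0,0,0,1,1,1,1,0,0,0,0,1,1,1,1,0,0,0,0],
    ![0,0,0,0,0,0,0,0,1,0,1,0,1,0,1,0,1,0,1,0,1,0,1,0],
    ![0,0,0,0,0,0,0,0,1,0,0,1,1,0,0,1,1,0,0,1,1,0,0,1],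
    ![0,0,0,0,0,0,0,0,1,0,0,1,0,1,1,0,1,0,0,1,0,1,1,0],
    ![1,1,0,1,1,0,0,0,1,1,0,1,1,0,0,0,1,1,0,1,1,0,0,0],
    ![1,0,1,1,0,0,1,0,1,0,1,1,0,0,1,0,1,0,1,1,0,0,1,0],
    ![1,0,0,0,1,0,1,1,1,0,0,0,1,0,1,1,1,0,0,0,1,0,1,1],
    ![1,0,0,1,0,1,0,1,1,0,0,1,0,1,0,1,1,0,0,1,0,1,0,1]] := by
  decide +kernel

theorem golay_wt_eq (b0 b1 b2 b3 b4 b5 b6 b7 b8 b9 b10 b11 : Bool) :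
    hammingNorm (∑ i, (![ofB b0, ofB b1, ofB b2, ofB b3, ofB b4, ofB b5, ofB b6, ofB b7, ofB b8, ofB b9, ofB b10, ofB b11] : Fin 12 → ZMod 2) i • golayRows i)
      = golayWt b0 b1 b2 b3 b4 b5 b6 b7 b8 b9 b10 b11 := by
  rw [golayRows_eq]
  simp [hammingNorm, Finset.card_filter, Fin.sum_univ_succ, golayWt, ofB_add, ofB_ite, add_assoc]

theorem golay_key (c : Fin 12 → ZMod 2) :
    8 ≤ hammingNorm (∑ i, c i • golayRows i) ∨ c = 0 := by
  choose b hb using fun i => ofB_surj (c i)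
  have hc : c = ![ofB (b 0), ofB (b 1), ofB (b 2), ofB (b 3), ofB (b 4), ofB (b 5), ofB (b 6), ofB (b 7), ofB (b 8), ofB (b 9), ofB (b 10), ofB (b 11)] := by
    funext i
    fin_cases i <;> exact hb _
  rcases golayWt_check (b 0) (b 1) (b 2) (b 3) (b 4) (b 5) (b 6) (b 7) (b 8) (b 9) (b 10) (b 11) with h | h
  · left
    rw [hc, golay_wt_eq]
    exact h
  · right
    simp only [Bool.or_eq_false_iff] at h
    funext i
    fin_cases i <;> simp [hb, h, ofB]

theorem golay_linInd : LinearIndependent (ZMod 2) golayRows := by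
  rw [Fintype.linearIndependent_iff]
  intro g hg i
  rcases golay_key g with h | h
  · rw [hg] at h
    simp at h
  · simp [h]

theorem golay_finrank : Module.finrank (ZMod 2) CG = 12 := by
  rw [CG, finrank_span_eq_card golay_linInd]
  simp

theorem golay_rows_orth : ∀ i j, ∑ k, golayRows i k * golayRows j k = 0 := by
  rw [golayRows_eq]
  decide +kernel

theorem golay_orth (x y : Fin 24 → ZMod 2) (hx : x ∈ CG) (hy : y ∈ CG) :
    ∑ k, x k * y k = 0 := by
  change x ⬝ᵥ y = 0
  unfold CG at hx hy
  induction hx using Submodule.span_induction with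
  | mem x hx =>
    obtain ⟨i, rfl⟩ := hx
    induction hy using Submodule.span_induction with
    | mem y hy =>
      obtain ⟨j, rfl⟩ := hy
      exact golay_rows_orth i j
    | zero => simp
    | add _ _ _ _ h1 h2 => simp [dotProduct_add, h1, h2]
    | smul a _ _ h => simp [dotProduct_smul, h]
  | zero => simp
  | add _ _ _ _ h1 h2 => simp [add_dotProduct, h1, h2]
  | smul a _ _ h => simp [smul_dotProduct, h]

theorem golay_dual_le (x : Fin 24 → ZMod 2) (hx : ∀ c ∈ CG, ∑ i, x i * c i = 0) : x ∈ CG := by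
  have happ : ∀ u v, Matrix.toBilin' (1 : Matrix (Fin 24) (Fin 24) (ZMod 2)) u v = u ⬝ᵥ v := by
    intro u v
    rw [Matrix.toBilin'_apply', Matrix.one_mulVec]
  have hN : (Matrix.toBilin' (1 : Matrix (Fin 24) (Fin 24) (ZMod 2))).Nondegenerate := by
    apply LinearMap.BilinForm.nondegenerate_toBilin'_of_det_ne_zero'
    simp
  have hfr := LinearMap.BilinForm.finrank_orthogonal hN CG
  rw [golay_finrank, Module.finrank_fin_fun] at hfr
  have hle : CG ≤ (Matrix.toBilin' (1 : Matrix (Fin 24) (Fin 24) (ZMod 2))).orthogonal CG := by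
    intro u hu v hv
    exact (happ v u).trans (golay_orth v u hv hu)
  have heq := Submodule.eq_of_le_of_finrank_eq hle (by rw [hfr, golay_finrank])
  rw [heq]
  intro v hv
  refine (happ v x).trans ?_
  rw [dotProduct_comm]
  exact hx v hv



/-- The extended Golay code is a self-dual `(24,12,8)` code: it has dimension 12,
minimum nonzero Hamming weight exactly 8, and equals its dual code. -/
theorem golay_24_12_8_selfDual :
    Module.finrank (ZMod 2) CG = 12 ∧
    (∀ x ∈ CG, x ≠ 0 → 8 ≤ hammingNorm x) ∧
    (∃ x ∈ CG, hammingNorm x = 8) ∧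
    (∀ x : Fin 24 → ZMod 2, x ∈ CG ↔ ∀ c ∈ CG, ∑ i, x i * c i = 0) := by
  refine ⟨golay_finrank, ?_, ⟨golayRows 0, Submodule.subset_span ⟨0, rfl⟩, ?_⟩,
    fun x => ⟨fun hx c hc => golay_orth x c hx hc, golay_dual_le x⟩⟩
  · intro x hx hx0
    obtain ⟨c, rfl⟩ := (Submodule.mem_span_range_iff_exists_fun (ZMod 2)).1 hx
    rcases golay_key c with h | h
    · exact h
    · exact absurd (by simp [h]) hx0
  · rw [golayRows_eq]
    decide +kernel
end

section
/- Let C_G ⊆ F₂^24 be the extended Golay code. Then C_G is quasi-perfect with covering radius 4: for every y ∈ F₂^24 there exists c ∈ C_G with Hamming distance d(y,c) ≤ 4, and there exists y ∈ F₂^24 such that every c ∈ C_G satisfies d(y,c) ≥ 4. -/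
namespace GolayAux

/-- Vectors over `F₂` read off from the bits of a natural number. -/
def bvec (f : Fin 24 → ℕ) (s : ℕ) : Fin 24 → ZMod 2 := fun i => if s.testBit (f i) then 1 else 0

theorem bvec_xor (f : Fin 24 → ℕ) (s t : ℕ) : bvec f (s ^^^ t) = bvec f s + bvec f t := by
  funext i
  simp only [bvec, Nat.testBit_xor, Pi.add_apply]
  cases s.testBit (f i) <;> cases t.testBit (f i) <;> decide

theorem bvec_zero (f : Fin 24 → ℕ) : bvec f 0 = 0 := by
  funext i
  simp [bvec]

/-- Position of a check coordinate among the check coordinates (12 for the others). -/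
def jidx (i : Fin 24) : ℕ :=
  [12,12,12,12,12,12,12,0,12,12,12,1,12,2,3,4,12,5,6,7,8,9,10,11].getD i 0

/-- Syndrome of the `i`-th unit vector. -/
def col (i : ℕ) : ℕ :=
  [607, 1255, 3627, 1939, 941, 2517, 1401, 1, 2414, 2742, 3290, 2, 3868, 4, 8, 16, 4064, 32, 64,
    128, 256, 512, 1024, 2048].getD i 0

/-- Which rows of `G` reduce the `i`-th unit vector to its syndrome. -/
def msk (i : ℕ) : ℕ :=
  [742, 2665, 3999, 3276, 1523, 1706, 853, 0, 2909, 240, 96, 0, 192, 0, 0, 0, 3037, 0, 0, 0, 0,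
    0, 0, 0].getD i 0

theorem single_eq : ∀ i j : Fin 24, (Pi.single i 1 : Fin 24 → ZMod 2) j - bvec jidx (col i) j =
    ∑ k : Fin 12, if (msk i).testBit k then golayRows k j else 0 := by
  decide +kernel

theorem row_mem (k : Fin 12) : golayRows k ∈ CG := Submodule.subset_span ⟨k, rfl⟩

theorem single_mem (i : Fin 24) : (Pi.single i 1 : Fin 24 → ZMod 2) - bvec jidx (col i) ∈ CG := by
  have h : (Pi.single i 1 : Fin 24 → ZMod 2) - bvec jidx (col i) =
      ∑ k : Fin 12, if (msk i).testBit k then golayRows k else 0 := by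
    funext j
    rw [Pi.sub_apply, single_eq i j, Finset.sum_apply]
    refine Finset.sum_congr rfl fun k _ => ?_
    split <;> rfl
  rw [h]
  refine Submodule.sum_mem _ fun k _ => ?_
  split
  · exact row_mem k
  · exact Submodule.zero_mem _

theorem col_lt : ∀ i : Fin 24, col i < 2 ^ 12 := by decide

/-- Every vector is congruent modulo the code to one given by a 12-bit syndrome. -/
theorem exists_syndrome (y : Fin 24 → ZMod 2) : ∃ t < 2 ^ 12, y - bvec jidx t ∈ CG := by
  have hy : y = ∑ i, Pi.single i (y i) := (Finset.univ_sum_single y).symm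
  rw [hy]
  refine Finset.sum_induction _ (fun v => ∃ t < 2 ^ 12, v - bvec jidx t ∈ CG) ?_ ?_ ?_
  · rintro a b ⟨s, hs, ha⟩ ⟨t, ht, hb⟩
    refine ⟨s ^^^ t, Nat.xor_lt_two_pow hs ht, ?_⟩
    rw [bvec_xor, add_sub_add_comm]
    exact Submodule.add_mem _ ha hb
  · exact ⟨0, by norm_num, by rw [bvec_zero, sub_zero]; exact Submodule.zero_mem _⟩
  · intro i _
    have h01 : ∀ z : ZMod 2, z = 0 ∨ z = 1 := by decide
    rcases h01 (y i) with h | h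
    · refine ⟨0, by norm_num, ?_⟩
      rw [h, bvec_zero, sub_zero, Pi.single_zero]
      exact Submodule.zero_mem _
    · rw [h]
      exact ⟨col i, col_lt i, single_mem i⟩

/-- Bit set of all `s ^^^ (syndrome of e)` with `e` of weight at most `d` supported below `n`. -/
def cover : ℕ → ℕ → ℕ → ℕ
  | 0, _, s => 1 <<< s
  | _ + 1, 0, s => 1 <<< s
  | n + 1, d + 1, s => cover n (d + 1) s ||| cover n d (s ^^^ col n)

theorem cover_base {d s t : ℕ} (h : (1 <<< s).testBit t = true) :
    ∃ e : Fin 24 → ZMod 2, hammingNorm e ≤ d ∧ bvec jidx s + e - bvec jidx t ∈ CG := by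
  have hst : s = t := by
    rw [Nat.one_shiftLeft, Nat.testBit_two_pow] at h
    simpa using h
  subst hst
  refine ⟨0, by simp, ?_⟩
  simp

theorem dist_eq_norm_sub (x y : Fin 24 → ZMod 2) : hammingDist x y = hammingNorm (x - y) := by
  simp only [hammingDist, hammingNorm, Pi.sub_apply, sub_ne_zero]

theorem norm_add_le (x y : Fin 24 → ZMod 2) :
    hammingNorm (x + y) ≤ hammingNorm x + hammingNorm y := by
  have h := hammingDist_triangle x 0 (-y)
  rw [hammingDist_zero_right, hammingDist_zero_left, dist_eq_norm_sub] at h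
  have h2 : -y = y := by
    funext i
    exact ZMod.neg_eq_self_mod_two _
  rw [h2, show x - y = x + y by rw [sub_eq_add_neg, h2]] at h
  exact h

theorem norm_single : ∀ i : Fin 24, hammingNorm (Pi.single i 1 : Fin 24 → ZMod 2) ≤ 1 := by
  decide +kernel

theorem cover_sound : ∀ n ≤ 24, ∀ d s t : ℕ, (cover n d s).testBit t = true →
    ∃ e : Fin 24 → ZMod 2, hammingNorm e ≤ d ∧ bvec jidx s + e - bvec jidx t ∈ CG := by
  intro n
  induction n with
  | zero => intro _ d s t h; exact cover_base h
  | succ n ih =>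
    intro hn d s t h
    cases d with
    | zero => exact cover_base h
    | succ d =>
      rw [cover, Nat.testBit_lor, Bool.or_eq_true] at h
      rcases h with h | h
      · exact ih (by omega) _ _ _ h
      · obtain ⟨e, he, hm⟩ := ih (by omega) _ _ _ h
        have hs := single_mem ⟨n, by omega⟩
        have h1 := norm_single ⟨n, by omega⟩
        refine ⟨e + Pi.single ⟨n, by omega⟩ 1, (norm_add_le _ _).trans (by omega), ?_⟩
        rw [bvec_xor] at hm
        convert Submodule.add_mem _ hm hs using 1
        abel

theorem cover_full : cover 24 4 0 = 2 ^ 4096 - 1 := by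
  decide +kernel

theorem covering (y : Fin 24 → ZMod 2) : ∃ c ∈ CG, hammingDist y c ≤ 4 := by
  obtain ⟨t, ht, hy⟩ := exists_syndrome y
  have hb : (cover 24 4 0).testBit t = true := by
    rw [cover_full, Nat.testBit_two_pow_sub_one]
    simpa using ht
  obtain ⟨e, he, hm⟩ := cover_sound 24 le_rfl 4 0 t hb
  refine ⟨y - e, ?_, ?_⟩
  · rw [bvec_zero, zero_add] at hm
    convert Submodule.sub_mem _ hy hm using 1
    abel
  · rw [dist_eq_norm_sub, sub_sub_cancel]
    exact he

/-- The rows of `G` as bit masks. -/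
def rowN (k : ℕ) : ℕ :=
  [983055, 5570645, 10027161, 6881385, 986880, 5592320, 10066176, 6908160, 1776411, 5066061,
    13750737, 11119017].getD k 0

theorem rowN_eq : ∀ (k : Fin 12) (j : Fin 24), golayRows k j = bvec (fun i => i) (rowN k) j := by
  decide +kernel

/-- Number of ones among the lowest `k` bits. -/
def pop : ℕ → ℕ → ℕ
  | 0, _ => 0
  | k + 1, n => pop k n + (n >>> k) % 2

theorem norm_bvec (n : ℕ) : hammingNorm (bvec (fun i => i) n) = pop 24 n := by
  have hp : ∀ k, pop k n = ∑ i ∈ Finset.range k, (n >>> i) % 2 := by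
    intro k
    induction k with
    | zero => rfl
    | succ k ih => rw [pop, ih, Finset.sum_range_succ]
  rw [hp, Finset.sum_range, hammingNorm, Finset.card_filter]
  refine Finset.sum_congr rfl fun i _ => ?_
  have h2 := Nat.mod_two_eq_zero_or_one (n >>> (i : ℕ))
  simp only [bvec, Nat.testBit_eq_decide_div_mod_eq, Nat.shiftRight_eq_div_pow] at *
  rcases h2 with h | h <;> simp [h]

/-- All translates of `v` by combinations of the first `k` rows have weight at least 4. -/
def good : ℕ → ℕ → Bool
  | 0, v => Nat.ble 4 (pop 24 v)
  | k + 1, v => good k v && good k (v ^^^ rowN k)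

theorem good_sound : ∀ k v : ℕ, good k v = true → ∀ x : ℕ → ZMod 2,
    4 ≤ hammingNorm (bvec (fun i => i) v +
      ∑ i ∈ Finset.range k, x i • bvec (fun i => i) (rowN i)) := by
  intro k
  induction k with
  | zero =>
    intro v h x
    rw [Finset.sum_range_zero, add_zero, norm_bvec]
    exact Nat.le_of_ble_eq_true h
  | succ k ih =>
    intro v h x
    rw [good, Bool.and_eq_true] at h
    have h01 : ∀ z : ZMod 2, z = 0 ∨ z = 1 := by decide
    rw [Finset.sum_range_succ]
    rcases h01 (x k) with hx | hx
    · rw [hx, zero_smul, add_zero]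
      exact ih _ h.1 x
    · rw [hx, one_smul]
      have := ih _ h.2 x
      rw [bvec_xor] at this
      convert this using 2
      abel

theorem good_fifteen : good 12 15 = true := by
  decide +kernel

theorem far (c : Fin 24 → ZMod 2) (hc : c ∈ CG) :
    4 ≤ hammingDist (bvec (fun i => i) 15) c := by
  obtain ⟨x, rfl⟩ := (Submodule.mem_span_range_iff_exists_fun (ZMod 2)).1 hc
  have h := good_sound 12 15 good_fifteen
    (fun i => - if hi : i < 12 then x ⟨i, hi⟩ else 0)
  have hsum : ∑ i ∈ Finset.range 12, (- if hi : i < 12 then x ⟨i, hi⟩ else 0) •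
      bvec (fun i => i) (rowN i) = - ∑ k, x k • golayRows k := by
    rw [Finset.sum_range, ← Finset.sum_neg_distrib]
    refine Finset.sum_congr rfl fun k _ => ?_
    have hk : golayRows k = bvec (fun i => i) (rowN k) := funext (rowN_eq k)
    rw [hk, dif_pos k.isLt, neg_smul]
  rw [hsum, ← sub_eq_add_neg] at h
  rw [dist_eq_norm_sub]
  exact h

end GolayAux

/-- The extended Golay code is quasi-perfect with covering radius 4: every point of
`F₂²⁴` is within Hamming distance 4 of a codeword, and some point is at distance at
least 4 from every codeword. -/
theorem golay_quasiPerfect_coveringRadius_four :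
    (∀ y : Fin 24 → ZMod 2, ∃ c ∈ CG, hammingDist y c ≤ 4) ∧
    (∃ y : Fin 24 → ZMod 2, ∀ c ∈ CG, 4 ≤ hammingDist y c) :=
  ⟨GolayAux.covering, _, GolayAux.far⟩
end

section
/- Let p₀, p₁, q₀, q₁ be positive real numbers, and set a = log(p₀/p₁) and b = log(q₀/q₁). Then log( max(p₀·q₀, p₁·q₁) / max(p₀·q₁, p₁·q₀) ) = sgn(a)·sgn(b)·min(|a|, |b|), where sgn(x) is 1 for x > 0, −1 for x < 0, and 0 for x = 0. (This is the exact min-sum 'box-plus' identity a ⊞ b for log-likelihood ratios of most-likely-continuation probabilities in successive cancellation decoding.) -/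
theorem log_max_aux (x y : ℝ) (hx : 0 < x) (hy : 0 < y) :
    Real.log (max x y) = max (Real.log x) (Real.log y) := by
  rcases le_total x y with h | h
  · rw [max_eq_right h, max_eq_right (Real.log_le_log hx h)]
  · rw [max_eq_left h, max_eq_left (Real.log_le_log hy h)]

theorem real_aux (a b c d : ℝ) :
    max (a + c) (b + d) - max (a + d) (b + c) =
      Real.sign (a - b) * Real.sign (c - d) * min |a - b| |c - d| := by
  rcases lt_trichotomy (a - b) 0 with h | h | h <;>
  rcases lt_trichotomy (c - d) 0 with k | k | k <;>
  simp only [h, k, Real.sign_of_neg, Real.sign_of_pos, Real.sign_zero, abs_of_neg, abs_of_pos,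
    abs_zero] <;>
  grind

/-- The exact min-sum "box-plus" identity `a ⊞ b = sgn(a)·sgn(b)·min(|a|,|b|)` for
log-likelihood ratios `a = log(p₀/p₁)`, `b = log(q₀/q₁)` of most-likely-continuation
probabilities in successive cancellation decoding. -/
theorem boxplus_min_sum (p₀ p₁ q₀ q₁ : ℝ)
    (hp₀ : 0 < p₀) (hp₁ : 0 < p₁) (hq₀ : 0 < q₀) (hq₁ : 0 < q₁) :
    Real.log (max (p₀ * q₀) (p₁ * q₁) / max (p₀ * q₁) (p₁ * q₀)) =
      Real.sign (Real.log (p₀ / p₁)) * Real.sign (Real.log (q₀ / q₁)) *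
        min |Real.log (p₀ / p₁)| |Real.log (q₀ / q₁)| := by
  rw [Real.log_div (by positivity) (by positivity), log_max_aux _ _ (by positivity) (by positivity),
    log_max_aux _ _ (by positivity) (by positivity), Real.log_mul hp₀.ne' hq₀.ne',
    Real.log_mul hp₁.ne' hq₁.ne', Real.log_mul hp₀.ne' hq₁.ne', Real.log_mul hp₁.ne' hq₀.ne',
    Real.log_div hp₀.ne' hp₁.ne', Real.log_div hq₀.ne' hq₁.ne']
  exact real_aux _ _ _ _
end

section
/- Let p₀, p₁ be positive real numbers, let u ∈ {0, 1}, and set S = log(p₀/p₁). Define τ(S, u) = 0 if (−1)^u·S > 0, and τ(S, u) = −|S| otherwise. Then log(p_u) − log(max(p₀, p₁)) = τ(S, u). (This is the path-score update identity: the score of extending a path by the symbol value u changes by τ of the modified log-likelihood ratio S.) -/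
/-- The path-score update identity: for `S = log(p₀/p₁)` and `u ∈ {0,1}`,
`log p_u − log max(p₀,p₁) = τ(S,u)`, where `τ(S,u) = 0` if `(−1)ᵘ·S > 0`
and `τ(S,u) = −|S|` otherwise. -/
theorem path_score_update (p₀ p₁ : ℝ) (hp₀ : 0 < p₀) (hp₁ : 0 < p₁)
    (u : ℕ) (hu : u = 0 ∨ u = 1) :
    Real.log (if u = 0 then p₀ else p₁) - Real.log (max p₀ p₁) =
      if 0 < (-1 : ℝ) ^ u * Real.log (p₀ / p₁) then 0 else -|Real.log (p₀ / p₁)| := by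
  rw [Real.log_div hp₀.ne' hp₁.ne']
  have hmax : Real.log (max p₀ p₁) = max (Real.log p₀) (Real.log p₁) := by
    rcases le_total p₀ p₁ with h | h
    · rw [max_eq_right h, max_eq_right (Real.log_le_log hp₀ h)]
    · rw [max_eq_left h, max_eq_left (Real.log_le_log hp₁ h)]
  rw [hmax]
  clear hmax
  rcases hu with rfl | rfl
  · simp only [if_true, pow_zero, one_mul]
    split_ifs with h
    · rw [max_eq_left (by linarith)]; ring
    · rw [max_eq_right (by linarith), abs_of_nonpos (by linarith)]; ring
  · simp only [one_ne_zero, if_false, pow_one]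
    split_ifs with h
    · rw [max_eq_right (by linarith)]; ring
    · rw [max_eq_left (by linarith), abs_of_nonneg (by linarith)]; ring
end

section
/- Let C_G ⊆ F₂^24 be the extended Golay code and let π : F₂^24 → F₂^16 be the projection onto the first 16 coordinates (coordinates 0 through 15). Then the image π(C_G) is an F₂-linear subspace of F₂^16 of dimension 11 whose nonzero elements all have Hamming weight at least 4, with some element of weight exactly 4; i.e., puncturing the last 8 symbols of the extended Golay code yields a (16,11,4) code (the extended Hamming code of length 16). -/
/-- The parity check matrix of the extended Hamming code of length 16. -/
def hamH : Matrix (Fin 5) (Fin 16) (ZMod 2) :=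
  !![1,1,1,1,1,1,1,1,1,1,1,1,1,1,1,1;
     0,1,0,1,0,1,0,1,0,1,0,1,0,1,0,1;
     0,0,1,1,0,0,1,1,0,0,1,1,0,0,1,1;
     0,0,0,0,1,1,1,1,0,0,0,0,1,1,1,1;
     0,0,0,0,0,0,0,0,1,1,1,1,1,1,1,1]

/-- A right inverse of the parity check matrix. -/
def hamR : Matrix (Fin 16) (Fin 5) (ZMod 2) := fun i k =>
  if i = 0 ∨ (i = 1 ∧ k = 1) ∨ (i = 2 ∧ k = 2) ∨ (i = 4 ∧ k = 3) ∨ (i = 8 ∧ k = 4) then 1 else 0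

/-- A right inverse of the matrix of the last 11 punctured rows. -/
def leftInvW : Matrix (Fin 16) (Fin 11) (ZMod 2) :=
  !![1, 1, 0, 0, 1, 1, 1, 0, 1, 0, 0;
     0, 1, 0, 1, 1, 0, 1, 1, 0, 0, 0;
     1, 0, 0, 0, 0, 1, 0, 0, 0, 1, 0;
     0, 1, 1, 0, 0, 1, 1, 0, 0, 1, 1;
     1, 1, 1, 0, 1, 0, 0, 0, 1, 1, 1;
     1, 0, 1, 0, 1, 0, 1, 0, 1, 1, 0;
     0, 0, 1, 0, 0, 0, 1, 0, 0, 0, 1;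
     0, 0, 0, 0, 0, 0, 0, 0, 0, 0, 0;
     0, 0, 0, 0, 0, 0, 1, 0, 0, 0, 0;
     0, 0, 0, 1, 1, 1, 1, 0, 0, 0, 0;
     0, 0, 0, 0, 1, 1, 0, 0, 0, 0, 0;
     0, 0, 0, 0, 0, 0, 0, 0, 0, 0, 0;
     0, 0, 0, 0, 0, 1, 1, 0, 0, 0, 0;
     0, 0, 0, 0, 0, 0, 0, 0, 0, 0, 0;
     0, 0, 0, 0, 0, 0, 0, 0, 0, 0, 0;
     0, 0, 0, 0, 0, 0, 0, 0, 0, 0, 0]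

/-- The punctured code. -/
abbrev PC : Submodule (ZMod 2) (Fin 16 → ZMod 2) :=
  Submodule.map
    (LinearMap.funLeft (ZMod 2) (ZMod 2) (Fin.castLE (by norm_num : (16:ℕ) ≤ 24))) CG

/-- The punctured rows. -/
def prow (i : Fin 12) : Fin 16 → ZMod 2 :=
  fun j => golayRows i (Fin.castLE (by norm_num : (16:ℕ) ≤ 24) j)

lemma prow_mem (i : Fin 12) : prow i ∈ PC :=
  Submodule.mem_map_of_mem (Submodule.subset_span ⟨i, rfl⟩)

set_option maxRecDepth 100000 in
lemma hamH_prow : ∀ i : Fin 12, ∀ k, hamH.mulVec (prow i) k = 0 := by decide +kernel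

set_option maxRecDepth 100000 in
lemma prow_W : ∀ i j : Fin 11, leftInvW.vecMul (prow i.succ) j = (Pi.single i 1 : Fin 11 → ZMod 2) j := by
  decide +kernel

lemma PC_le : PC ≤ LinearMap.ker hamH.mulVecLin := by
  rw [Submodule.map_le_iff_le_comap, CG, Submodule.span_le]
  rintro _ ⟨i, rfl⟩
  exact funext (hamH_prow i)

lemma col_ne : ∀ i : Fin 16, ∃ k, hamH k i ≠ 0 := by decide +kernel

lemma col_add : ∀ i j : Fin 16, i ≠ j → ∃ k, hamH k i + hamH k j ≠ 0 := by decide +kernel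

lemma col_zero : ∀ i : Fin 16, hamH 0 i = 1 := by decide +kernel

lemma hamR_spec : ∀ k : Fin 5, ∀ l, hamH.mulVec (fun i => hamR i k) l =
    (Pi.single k 1 : Fin 5 → ZMod 2) l := by decide +kernel

lemma top_le_of_single {n : ℕ} (S : Submodule (ZMod 2) (Fin n → ZMod 2))
    (h : ∀ i, (Pi.single i 1 : Fin n → ZMod 2) ∈ S) : S = ⊤ := by
  rw [eq_top_iff, ← (Pi.basisFun (ZMod 2) (Fin n)).span_eq, Submodule.span_le]
  rintro _ ⟨i, rfl⟩
  simpa using h i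

lemma finrank_ker : Module.finrank (ZMod 2) (LinearMap.ker hamH.mulVecLin) = 11 := by
  have h := LinearMap.finrank_range_add_finrank_ker hamH.mulVecLin
  rw [top_le_of_single (LinearMap.range hamH.mulVecLin)
    (fun k => LinearMap.mem_range.2 ⟨fun i => hamR i k,
      (Matrix.mulVecLin_apply _ _).trans (funext (hamR_spec k))⟩)] at h
  simp at h
  omega

lemma finrank_ge : 11 ≤ Module.finrank (ZMod 2) PC := by
  have h := Submodule.finrank_map_le leftInvW.vecMulLinear PC
  rw [top_le_of_single (PC.map leftInvW.vecMulLinear)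
    (fun k => Submodule.mem_map.2 ⟨prow k.succ, prow_mem k.succ,
      (Matrix.vecMulLinear_apply _ _).trans (funext (prow_W k))⟩)] at h
  simpa using h

lemma weight_ge (x : Fin 16 → ZMod 2) (hx : hamH.mulVec x = 0) (h0 : x ≠ 0) :
    4 ≤ hammingNorm x := by
  have key : ∀ k, ∑ i ∈ Finset.univ.filter (fun i => x i ≠ 0), hamH k i = 0 := by
    intro k
    have hk : ∑ i, hamH k i * x i = 0 := by
      have := congrFun hx k
      rwa [Matrix.mulVec, dotProduct] at this
    refine Eq.trans ?_ hk
    rw [Finset.sum_filter]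
    refine Finset.sum_congr rfl fun i _ => ?_
    generalize hamH k i = b
    generalize x i = a
    revert a b
    decide
  have hpos := hammingNorm_pos_iff.2 h0
  unfold hammingNorm at *
  generalize Finset.univ.filter (fun i => x i ≠ 0) = s at *
  by_contra hlt
  have hc : s.card = 1 ∨ s.card = 2 ∨ s.card = 3 := by omega
  rcases hc with hc | hc | hc
  · obtain ⟨i, rfl⟩ := Finset.card_eq_one.1 hc
    obtain ⟨k, hk⟩ := col_ne i
    exact hk (by simpa using key k)
  · obtain ⟨i, j, hij, rfl⟩ := Finset.card_eq_two.1 hc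
    obtain ⟨k, hk⟩ := col_add i j hij
    exact hk (by simpa [Finset.sum_pair hij] using key k)
  · have h := key 0
    simp only [col_zero, Finset.sum_const, hc] at h
    exact absurd h (by decide)

lemma prow_zero_weight : hammingNorm (prow 0) = 4 := by decide +kernel

/-- Puncturing the last 8 symbols of the extended Golay code (projecting onto
coordinates 0–15) yields the `(16,11,4)` extended Hamming code: an 11-dimensional
subspace of `F₂¹⁶` with minimum nonzero Hamming weight exactly 4. -/
theorem golay_punctured_16_11_4 :
    Module.finrank (ZMod 2)
        (Submodule.map
          (LinearMap.funLeft (ZMod 2) (ZMod 2) (Fin.castLE (by norm_num : (16:ℕ) ≤ 24))) CG)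
      = 11 ∧
    (∀ x ∈ Submodule.map
        (LinearMap.funLeft (ZMod 2) (ZMod 2) (Fin.castLE (by norm_num : (16:ℕ) ≤ 24))) CG,
      x ≠ 0 → 4 ≤ hammingNorm x) ∧
    (∃ x ∈ Submodule.map
        (LinearMap.funLeft (ZMod 2) (ZMod 2) (Fin.castLE (by norm_num : (16:ℕ) ≤ 24))) CG,
      hammingNorm x = 4) := by
  refine ⟨le_antisymm ?_ finrank_ge, fun x hx h0 => weight_ge x (PC_le hx) h0,
    prow 0, prow_mem 0, prow_zero_weight⟩
  rw [← finrank_ker]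
  exact Submodule.finrank_mono PC_le
end
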